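/- arXiv:1203.4024 — 6 statements merged into one kernel-verified Lean document; each statement's English description precedes it below -/
import Mathlib

section
/- For all integers N, q, every Q ∈ ℚ, and every integer i with i ≤ N, the Laurent polynomial z^i − Σ_{k=1}^{N−q} Σ_{j=1}^{k} C(−Q, −i+q+j)·C(Q, k−j)·z^{q+k} lies in the subspace O(N,Q,q;z). -/
open Finset

/-- Generalized binomial coefficient `C(Q,i)` for `Q ∈ ℚ` and `i ∈ ℤ`:
`C(Q,i) = Q(Q−1)⋯(Q−i+1)/i!` for `i ≥ 0` and `C(Q,i) = 0` for `i < 0`. -/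
noncomputable def genBinom (Q : ℚ) (i : ℤ) : ℚ :=
  if 0 ≤ i then (∏ j ∈ Finset.range i.toNat, (Q - j)) / (i.toNat.factorial) else 0

/-- The Laurent polynomial `f_j(z) = Σ_{i=0}^{N−q−j} C(Q,i)·z^{i+q+j}`. -/
noncomputable def Opoly (N : ℤ) (Q : ℚ) (q j : ℤ) : LaurentPolynomial ℂ :=
  ∑ i ∈ Finset.range ((N - q - j + 1).toNat),
    ((genBinom Q i : ℚ) : ℂ) • LaurentPolynomial.T (q + j + i)

/-- The subspace `O(N,Q,q;z)` of `ℂ[z,z⁻¹]`: the span of the `f_j(z)` for `j ≤ 0`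
together with the monomials `z^i` for `i ≥ N+1`. -/
noncomputable def Osub (N : ℤ) (Q : ℚ) (q : ℤ) : Submodule ℂ (LaurentPolynomial ℂ) :=
  Submodule.span ℂ
    ({f | ∃ j : ℤ, j ≤ 0 ∧ f = Opoly N Q q j} ∪
     {f | ∃ i : ℤ, N + 1 ≤ i ∧ f = LaurentPolynomial.T i})

theorem genBinom_of_neg (Q : ℚ) {i : ℤ} (hi : i < 0) : genBinom Q i = 0 :=
  if_neg (not_le.mpr hi)

theorem descPochhammer_smeval_eq_prod_range (Q : ℚ) (n : ℕ) :
    (descPochhammer ℤ n).smeval Q = ∏ j ∈ range n, (Q - j) := by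
  induction n with
  | zero => simp
  | succ n ih =>
    rw [descPochhammer_succ_right, Polynomial.smeval_mul, ih, prod_range_succ,
      Polynomial.smeval_sub, Polynomial.smeval_X, Polynomial.smeval_natCast]
    simp

theorem genBinom_natCast (Q : ℚ) (n : ℕ) : genBinom Q n = Ring.choose Q n := by
  rw [Ring.choose_eq_smul, descPochhammer_smeval_eq_prod_range, genBinom,
    if_pos (Int.natCast_nonneg n), Int.toNat_natCast, smul_eq_mul, div_eq_inv_mul]

/-- The Chu-Vandermonde identity for `(1 + z)^(-Q) (1 + z)^Q = 1`, summed over an integer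
interval large enough to contain all nonzero terms. -/
theorem sum_genBinom_neg_mul_genBinom (Q : ℚ) {a b m k : ℤ} (ham : a ≤ m) (hkb : k ≤ b) :
    ∑ j ∈ Icc a b, genBinom (-Q) (j - m) * genBinom Q (k - j) = if k = m then 1 else 0 := by
  rcases lt_or_ge k m with hkm | hmk
  · rw [if_neg hkm.ne]
    refine sum_eq_zero fun j _ => ?_
    rcases lt_or_ge j m with hj | hj
    · rw [genBinom_of_neg _ (by lia), zero_mul]
    · rw [genBinom_of_neg Q (by lia), mul_zero]
  · obtain ⟨n, rfl⟩ : ∃ n : ℕ, k = m + n := ⟨(k - m).toNat, by lia⟩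
    have hV := Ring.add_choose_eq n (Commute.all (-Q) Q)
    rw [neg_add_cancel, Ring.choose_zero_ite] at hV
    have hif : (if m + (n : ℤ) = m then (1 : ℚ) else 0) = if n = 0 then 1 else 0 := by simp
    rw [hif, hV]
    symm
    refine sum_of_injOn (fun p : ℕ × ℕ => m + (p.1 : ℤ)) ?_ ?_ ?_ ?_
    · rintro ⟨p, p'⟩ hp ⟨r, r'⟩ hr h
      simp only [mem_coe, HasAntidiagonal.mem_antidiagonal] at hp hr h
      ext <;> grind
    · rintro ⟨p, p'⟩ hp
      simp only [mem_coe, HasAntidiagonal.mem_antidiagonal] at hp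
      simp only [mem_coe, mem_Icc]
      lia
    · intro j _ hj
      rcases lt_or_ge j m with hjm | hjm
      · rw [genBinom_of_neg _ (by lia), zero_mul]
      rcases lt_or_ge (m + n) j with hjn | hjn
      · rw [genBinom_of_neg Q (by lia), mul_zero]
      refine absurd ⟨((j - m).toNat, (m + n - j).toNat), ?_, ?_⟩ hj
      · simp only [mem_coe, HasAntidiagonal.mem_antidiagonal]
        lia
      · simp only
        lia
    · rintro ⟨p, p'⟩ hp
      simp only [HasAntidiagonal.mem_antidiagonal] at hp
      rw [← genBinom_natCast, ← genBinom_natCast]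
      congr 2 <;> lia

theorem Opoly_eq_sum_Icc (N : ℤ) (Q : ℚ) (q : ℤ) {a j : ℤ} (haj : a ≤ j) :
    Opoly N Q q j = ∑ k ∈ Icc a (N - q),
      ((genBinom Q (k - j) : ℚ) : ℂ) • LaurentPolynomial.T (q + k) := by
  refine sum_of_injOn (fun i : ℕ => j + (i : ℤ)) ?_ ?_ ?_ ?_
  · intro x _ y _ h
    simpa using h
  · intro x hx
    simp only [mem_coe, mem_range] at hx
    simp only [mem_coe, mem_Icc]
    lia
  · intro k hk hkj
    rw [mem_Icc] at hk
    rcases lt_or_ge k j with h | h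
    · simp [genBinom_of_neg Q (show k - j < 0 by lia)]
    · refine absurd ⟨(k - j).toNat, ?_, ?_⟩ hkj
      · simp only [mem_coe, mem_range]
        lia
      · simp only
        lia
  · intro x _
    simp only [add_sub_cancel_left, add_assoc]

theorem T_eq_sum_smul_Opoly (N q : ℤ) (Q : ℚ) {a i : ℤ} (hi : i ≤ N) (ha : a ≤ i - q) :
    LaurentPolynomial.T i = ∑ j ∈ Icc a (N - q),
      ((genBinom (-Q) (-i + q + j) : ℚ) : ℂ) • Opoly N Q q j := by
  have hO : ∀ j ∈ Icc a (N - q),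
      ((genBinom (-Q) (-i + q + j) : ℚ) : ℂ) • Opoly N Q q j =
        ∑ k ∈ Icc a (N - q), ((genBinom (-Q) (j - (i - q)) * genBinom Q (k - j) : ℚ) : ℂ) •
          LaurentPolynomial.T (q + k) := by
    intro j hj
    rw [Opoly_eq_sum_Icc N Q q (mem_Icc.mp hj).1, smul_sum]
    refine sum_congr rfl fun k _ => ?_
    rw [smul_smul, Rat.cast_mul, show -i + q + j = j - (i - q) by ring]
  rw [sum_congr rfl hO, sum_comm]
  have hV : ∀ k ∈ Icc a (N - q),
      (∑ j ∈ Icc a (N - q), ((genBinom (-Q) (j - (i - q)) * genBinom Q (k - j) : ℚ) : ℂ) •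
        (LaurentPolynomial.T (q + k) : LaurentPolynomial ℂ)) =
        if k = i - q then LaurentPolynomial.T i else 0 := by
    intro k hk
    rw [← sum_smul, ← Rat.cast_sum, sum_genBinom_neg_mul_genBinom Q ha (mem_Icc.mp hk).2]
    split_ifs with h
    · simp [h]
    · simp
  rw [sum_congr rfl hV, sum_ite_eq', if_pos (mem_Icc.mpr ⟨ha, by lia⟩)]

theorem sum_smul_T_eq_sum_smul_Opoly (N q : ℤ) (Q : ℚ) (i : ℤ) :
    ∑ k ∈ Icc 1 (N - q), ∑ j ∈ Icc 1 k,
        ((genBinom (-Q) (-i + q + j) * genBinom Q (k - j) : ℚ) : ℂ) •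
          (LaurentPolynomial.T (q + k) : LaurentPolynomial ℂ) =
      ∑ j ∈ Icc 1 (N - q), ((genBinom (-Q) (-i + q + j) : ℚ) : ℂ) • Opoly N Q q j := by
  have hI : ∀ k ∈ Icc 1 (N - q),
      (∑ j ∈ Icc 1 k, ((genBinom (-Q) (-i + q + j) * genBinom Q (k - j) : ℚ) : ℂ) •
        (LaurentPolynomial.T (q + k) : LaurentPolynomial ℂ)) =
      ∑ j ∈ Icc 1 (N - q), ((genBinom (-Q) (-i + q + j) * genBinom Q (k - j) : ℚ) : ℂ) •
        LaurentPolynomial.T (q + k) := by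
    intro k hk
    refine sum_subset (Icc_subset_Icc_right (mem_Icc.mp hk).2) fun j hj hjk => ?_
    rw [mem_Icc] at hj hjk
    simp [genBinom_of_neg Q (show k - j < 0 by lia)]
  rw [sum_congr rfl hI, sum_comm]
  refine sum_congr rfl fun j hj => ?_
  rw [Opoly_eq_sum_Icc N Q q (mem_Icc.mp hj).1, smul_sum]
  refine sum_congr rfl fun k _ => ?_
  rw [smul_smul, Rat.cast_mul]

theorem stmt0 (N q : ℤ) (Q : ℚ) (i : ℤ) (hi : i ≤ N) :
    LaurentPolynomial.T i -
        ∑ k ∈ Finset.Icc 1 (N - q), ∑ j ∈ Finset.Icc 1 k,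
          ((genBinom (-Q) (-i + q + j) * genBinom Q (k - j) : ℚ) : ℂ) •
            LaurentPolynomial.T (q + k)
      ∈ Osub N Q q := by
  rw [sum_smul_T_eq_sum_smul_Opoly, T_eq_sum_smul_Opoly N q Q hi (min_le_left (i - q) 1),
    ← sum_sdiff (Icc_subset_Icc_left (min_le_right (i - q) 1)), add_sub_cancel_right]
  refine Submodule.sum_mem _ fun j hj => Submodule.smul_mem _ _ (Submodule.subset_span ?_)
  rw [mem_sdiff, mem_Icc, mem_Icc] at hj
  exact Or.inl ⟨j, by lia, rfl⟩
end

section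
/- Let T be a positive integer, N ∈ ℤ, q₀,…,q_{T−1} ∈ ℤ, and Q₀,…,Q_{T−1} ∈ ℚ such that Q_i − Q_j ∉ ℤ whenever i ≠ j. Then the linear map ℂ[z,z⁻¹] → ⊕_{s=0}^{T−1} ℂ[z,z⁻¹]/O(N,Q_s,q_s;z) sending f to (f mod O(N,Q_s,q_s;z))_{s=0,…,T−1} is surjective; consequently the diagonal map induces a linear isomorphism ℂ[z,z⁻¹]/∩_{s=0}^{T−1} O(N,Q_s,q_s;z) ≅ ⊕_{s=0}^{T−1} ℂ[z,z⁻¹]/O(N,Q_s,q_s;z). -/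
open Finset

/-- The generalized binomial coefficient at a natural number, as a product over a factorial. -/
theorem ringChoose_eq_prod_div (Q : ℚ) (n : ℕ) :
    Ring.choose Q n = (∏ j ∈ Finset.range n, (Q - j)) / n.factorial := by
  rw [Ring.choose_eq_smul, ← Polynomial.aeval_eq_smeval, Polynomial.aeval_def,
    Polynomial.eval₂_eq_eval_map, descPochhammer_map, descPochhammer_eval_eq_prod_range,
    smul_eq_mul, mul_comm, div_eq_mul_inv]

theorem ringChoose_succ_mul (Q : ℚ) (n : ℕ) :
    Ring.choose Q (n + 1) * (n + 1) = Ring.choose Q n * (Q - n) := by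
  rw [ringChoose_eq_prod_div, ringChoose_eq_prod_div, Finset.prod_range_succ, Nat.factorial_succ]
  have : (n.factorial : ℚ) ≠ 0 := by exact_mod_cast n.factorial_ne_zero
  push_cast
  field_simp

theorem one_add_X_mul_derivative_binomialSeries (Q : ℚ) :
    (1 + PowerSeries.X) * PowerSeries.derivative ℂ (PowerSeries.binomialSeries ℂ Q) =
      (Q : ℂ) • PowerSeries.binomialSeries ℂ Q := by
  ext n
  have h (n : ℕ) : ((Ring.choose Q (n + 1) : ℚ) : ℂ) * (n + 1) =
      ((Ring.choose Q n : ℚ) : ℂ) * (Q - n) := by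
    exact_mod_cast congrArg (Rat.cast : ℚ → ℂ) (ringChoose_succ_mul Q n)
  rw [add_mul, one_mul, map_add]
  cases n with
  | zero =>
    have h0 := h 0
    simp [PowerSeries.coeff_derivative, Rat.smul_def] at h0 ⊢
  | succ n =>
    have h1 := h (n + 1)
    simp only [PowerSeries.coeff_succ_X_mul, PowerSeries.coeff_derivative,
      PowerSeries.binomialSeries_coeff, PowerSeries.coeff_smul, Rat.smul_def, smul_eq_mul, mul_one]
    push_cast at h1 ⊢
    linear_combination h1

/-- The series `(1 + X) ^ Q`, `Q ∈ ℚ`, are linearly independent, being eigenvectors of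
`(1 + X) d/dX` for distinct eigenvalues. -/
theorem linearIndependent_binomialSeries :
    LinearIndependent ℂ (fun Q : ℚ => PowerSeries.binomialSeries ℂ Q) := by
  refine Module.End.eigenvectors_linearIndependent'
    (LinearMap.mulLeft ℂ (1 + PowerSeries.X : PowerSeries ℂ) ∘ₗ
      (PowerSeries.derivative ℂ).toLinearMap)
    (fun Q : ℚ => (Q : ℂ)) Rat.cast_injective _ fun Q => ⟨?_, ?_⟩
  · rw [Module.End.mem_eigenspace_iff]
    exact one_add_X_mul_derivative_binomialSeries Q
  · intro h
    simpa using congrArg PowerSeries.constantCoeff h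

/-- If `(1 + X) ^ Q * H` is a polynomial, then `H` is a combination of the `(1 + X) ^ (k - Q)`. -/
theorem mem_span_binomialSeries_of_mul_eq_polynomial {Q : ℚ} {H : PowerSeries ℂ}
    {P : Polynomial ℂ} (h : PowerSeries.binomialSeries ℂ Q * H = P) :
    H ∈ Submodule.span ℂ ((fun r : ℚ => PowerSeries.binomialSeries ℂ r) ''
      Set.range fun k : ℕ => (k : ℚ) - Q) := by
  have hH : H = PowerSeries.binomialSeries ℂ (-Q) * P := by
    rw [← h, ← mul_assoc, ← PowerSeries.binomialSeries_add]
    simp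
  have hP : P = ∑ k ∈ (P.comp (Polynomial.X - 1)).support,
      Polynomial.C ((P.comp (Polynomial.X - 1)).coeff k) * (1 + Polynomial.X) ^ k := by
    have h1 : P = (P.comp (Polynomial.X - 1)).comp (1 + Polynomial.X) := by
      simp [Polynomial.comp_assoc]
    conv_lhs => rw [h1]
    rw [Polynomial.comp, Polynomial.eval₂_eq_sum, Polynomial.sum_def]
  rw [hH, hP, ← Polynomial.coeToPowerSeries.ringHom_apply, map_sum, Finset.mul_sum]
  refine Submodule.sum_mem _ fun k _ => ?_
  have hk : PowerSeries.binomialSeries ℂ (-Q) * Polynomial.coeToPowerSeries.ringHom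
      (Polynomial.C ((P.comp (Polynomial.X - 1)).coeff k) * (1 + Polynomial.X) ^ k) =
      (P.comp (Polynomial.X - 1)).coeff k • PowerSeries.binomialSeries ℂ ((k : ℚ) - Q) := by
    rw [sub_eq_add_neg (k : ℚ), PowerSeries.binomialSeries_add, PowerSeries.binomialSeries_nat,
      PowerSeries.smul_eq_C_mul]
    simp
    ring
  rw [hk]
  exact Submodule.smul_mem _ _ (Submodule.subset_span ⟨_, ⟨k, rfl⟩, rfl⟩)

/-- Series `H s` with `(1 + X) ^ (Q s) * H s` polynomial, for exponents `Q s` pairwise distinct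
modulo `ℤ`, can only sum to zero if they all vanish. -/
theorem eq_zero_of_sum_eq_zero_of_mul_eq_polynomial {ι : Type*} [Fintype ι] {Q : ι → ℚ}
    (hQ : ∀ i j : ι, i ≠ j → ∀ z : ℤ, Q i - Q j ≠ z) {H : ι → PowerSeries ℂ}
    (hH : ∀ s, ∃ P : Polynomial ℂ, PowerSeries.binomialSeries ℂ (Q s) * H s = P)
    (hsum : ∑ s, H s = 0) (s : ι) : H s = 0 := by
  classical
  have hmem (t : ι) := mem_span_binomialSeries_of_mul_eq_polynomial (hH t).choose_spec
  have hdisj : Disjoint (Set.range fun k : ℕ => (k : ℚ) - Q s)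
      (⋃ t ∈ {t | t ≠ s}, Set.range fun k : ℕ => (k : ℚ) - Q t) := by
    rw [Set.disjoint_left]
    rintro _ ⟨k, rfl⟩ hx
    simp only [Set.mem_iUnion, Set.mem_range] at hx
    obtain ⟨t, hts, l, hl⟩ := hx
    refine hQ s t (Ne.symm hts) ((k : ℤ) - l) ?_
    push_cast
    linarith
  refine Submodule.disjoint_def.mp
    (linearIndependent_binomialSeries.disjoint_span_image hdisj) _ (hmem s) ?_
  rw [← Finset.add_sum_erase _ _ (Finset.mem_univ s)] at hsum
  rw [eq_neg_of_add_eq_zero_left hsum]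
  refine Submodule.neg_mem _ (Submodule.sum_mem _ fun t ht => ?_)
  refine Submodule.span_mono (Set.image_mono ?_) (hmem t)
  exact Set.subset_biUnion_of_mem (u := fun t => Set.range fun k : ℕ => (k : ℚ) - Q t)
    (Finset.ne_of_mem_erase ht)

/-- The generating series of the values of a functional on the monomials `z ^ i`, `i ≤ N`. -/
noncomputable def functionalSeries (N : ℤ) (φ : LaurentPolynomial ℂ →ₗ[ℂ] ℂ) : PowerSeries ℂ :=
  PowerSeries.mk fun n => φ (LaurentPolynomial.T (N - n))

theorem coeff_binomialSeries_mul_functionalSeries (N : ℤ) (Q : ℚ) (q : ℤ)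
    (φ : LaurentPolynomial ℂ →ₗ[ℂ] ℂ) (m : ℕ) :
    PowerSeries.coeff m (PowerSeries.binomialSeries ℂ Q * functionalSeries N φ) =
      φ (Opoly N Q q (N - q - m)) := by
  rw [PowerSeries.coeff_mul, Finset.Nat.sum_antidiagonal_eq_sum_range_succ
    (fun i j => PowerSeries.coeff i (PowerSeries.binomialSeries ℂ Q) *
      PowerSeries.coeff j (functionalSeries N φ)), Opoly, map_sum]
  have hm : (N - q - (N - q - m) + 1).toNat = m + 1 := by omega
  rw [hm]
  refine Finset.sum_congr rfl fun i hi => ?_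
  have hi' : i ≤ m := Nat.lt_succ_iff.mp (Finset.mem_range.mp hi)
  have he : q + (N - q - m) + i = N - ((m - i : ℕ) : ℤ) := by omega
  rw [map_smul, genBinom_natCast, he]
  simp [functionalSeries, Rat.smul_def]

theorem exists_polynomial_of_vanishes_on_Osub {N : ℤ} {Q : ℚ} {q : ℤ}
    {φ : LaurentPolynomial ℂ →ₗ[ℂ] ℂ} (hφ : ∀ f ∈ Osub N Q q, φ f = 0) :
    ∃ P : Polynomial ℂ, PowerSeries.binomialSeries ℂ Q * functionalSeries N φ = P := by
  refine ⟨PowerSeries.trunc (N - q).toNat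
    (PowerSeries.binomialSeries ℂ Q * functionalSeries N φ), ?_⟩
  ext m
  rw [Polynomial.coeff_coe, PowerSeries.coeff_trunc]
  split_ifs with h
  · rfl
  · rw [coeff_binomialSeries_mul_functionalSeries N Q q]
    exact hφ _ (Submodule.subset_span (Or.inl ⟨_, by omega, rfl⟩))

theorem eq_zero_of_functionalSeries_eq_zero {N : ℤ} {Q : ℚ} {q : ℤ}
    {φ : LaurentPolynomial ℂ →ₗ[ℂ] ℂ} (hφ : ∀ f ∈ Osub N Q q, φ f = 0)
    (h : functionalSeries N φ = 0) : φ = 0 := by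
  have hT (i : ℤ) : φ (LaurentPolynomial.T i) = 0 := by
    rcases le_or_gt i N with hi | hi
    · have hc := congrArg (PowerSeries.coeff (N - i).toNat) h
      have he : N - ((N - i).toNat : ℤ) = i := by omega
      rwa [functionalSeries, PowerSeries.coeff_mk, he, map_zero] at hc
    · exact hφ _ (Submodule.subset_span (Or.inr ⟨i, by omega, rfl⟩))
  refine LinearMap.ext fun f => ?_
  induction f using LaurentPolynomial.induction_on' with
  | add p q hp hq => rw [map_add, hp, hq]; simp
  | C_mul_T n a => rw [← LaurentPolynomial.smul_eq_C_mul, map_smul, hT]; simp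

theorem stmt1 (T : ℕ) (hT : 0 < T) (N : ℤ) (q : Fin T → ℤ) (Q : Fin T → ℚ)
    (hQ : ∀ i j : Fin T, i ≠ j → ∀ z : ℤ, Q i - Q j ≠ z) :
    Function.Surjective
      (LinearMap.pi (fun s : Fin T => (Osub N (Q s) (q s)).mkQ) :
        LaurentPolynomial ℂ →ₗ[ℂ] ∀ s : Fin T, LaurentPolynomial ℂ ⧸ Osub N (Q s) (q s)) ∧
    Nonempty ((LaurentPolynomial ℂ ⧸ ⨅ s : Fin T, Osub N (Q s) (q s)) ≃ₗ[ℂ]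
      ∀ s : Fin T, LaurentPolynomial ℂ ⧸ Osub N (Q s) (q s)) := by
  classical
  have hsurj : Function.Surjective
      (LinearMap.pi (fun s : Fin T => (Osub N (Q s) (q s)).mkQ) :
        LaurentPolynomial ℂ →ₗ[ℂ] ∀ s : Fin T, LaurentPolynomial ℂ ⧸ Osub N (Q s) (q s)) := by
    rw [← LinearMap.range_eq_top]
    by_contra hne
    obtain ⟨F, hF, hle⟩ := Submodule.exists_le_ker_of_lt_top _ (lt_top_iff_ne_top.mpr hne)
    let φ (s : Fin T) : LaurentPolynomial ℂ →ₗ[ℂ] ℂ :=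
      F ∘ₗ LinearMap.single ℂ (fun s => LaurentPolynomial ℂ ⧸ Osub N (Q s) (q s)) s ∘ₗ
        (Osub N (Q s) (q s)).mkQ
    have hφ (s : Fin T) : ∀ f ∈ Osub N (Q s) (q s), φ s f = 0 := by
      intro f hf
      have h0 : (Osub N (Q s) (q s)).mkQ f = 0 := by simpa using hf
      simp only [φ, LinearMap.comp_apply, h0, map_zero]
    have hsum (f : LaurentPolynomial ℂ) : ∑ s, φ s f = 0 := by
      have hf := hle ⟨f, rfl⟩
      rw [LinearMap.mem_ker, ← LinearMap.sum_single_apply _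
        (LinearMap.pi (fun s : Fin T => (Osub N (Q s) (q s)).mkQ) f), map_sum] at hf
      exact hf
    have hseries (s : Fin T) : functionalSeries N (φ s) = 0 := by
      refine eq_zero_of_sum_eq_zero_of_mul_eq_polynomial hQ
        (H := fun s => functionalSeries N (φ s))
        (fun s => exists_polynomial_of_vanishes_on_Osub (hφ s)) ?_ s
      ext n
      simpa [functionalSeries] using hsum (LaurentPolynomial.T (N - n))
    refine hF (LinearMap.pi_ext' fun s => Submodule.linearMap_qext _ ?_)
    exact eq_zero_of_functionalSeries_eq_zero (hφ s) (hseries s)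
  refine ⟨hsurj, ⟨(Submodule.quotEquivOfEq _ _ ?_).trans
    (LinearMap.quotKerEquivOfSurjective _ hsurj)⟩⟩
  simp [LinearMap.ker_pi]
end

section
/- Let m′ = l₁′ + i₁′/T and n′ = l₃′ + i₃′/T be elements of (1/T)ℕ with l₁′, l₃′ ∈ ℕ and 0 ≤ i₁′, i₃′ ≤ T−1, and suppose m′ ≤ m and n′ ≤ n. Then for every s ∈ {0,…,T−1} and all α, β ∈ ℤ, O^{T,s}_{n,m}(α,β;z) ⊆ O^{T,s}_{n′,m′}(α,β;z); in particular O^{T}_{n,m}(α,β;z) ⊆ O^{T}_{n′,m′}(α,β;z). -/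
open Finset

/-- `O^{T,s}_{n,m}(α,β;z)` where `m = l₁ + i₁/T` and `n = l₃ + i₃/T`. -/
noncomputable def OTs (T : ℕ) (Δ : ℤ) (l₁ i₁ l₃ i₃ s : ℕ) (α β : ℤ) :
    Submodule ℂ (LaurentPolynomial ℂ) :=
  Osub (α + β - 1 - Δ)
    ((α : ℚ) - 1 + l₁ + (if s ≤ i₁ then 1 else 0) + (s : ℚ) / T)
    (-(l₁ : ℤ) - l₃ - (if s ≤ i₁ then 1 else 0) - (if T ≤ s + i₃ then 1 else 0) - 1)

/-- `O^{T}_{n,m}(α,β;z) = ∩_{s=0}^{T−1} O^{T,s}_{n,m}(α,β;z)`. -/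
noncomputable def OT (T : ℕ) (Δ : ℤ) (l₁ i₁ l₃ i₃ : ℕ) (α β : ℤ) :
    Submodule ℂ (LaurentPolynomial ℂ) :=
  ⨅ s ∈ Finset.range T, OTs T Δ l₁ i₁ l₃ i₃ s α β

theorem genBinom_natCast_s5 (Q : ℚ) (n : ℕ) :
    genBinom Q n = (∏ j ∈ Finset.range n, (Q - j)) / n.factorial := by
  simp [genBinom]

theorem genBinom_add_one_succ (Q : ℚ) (n : ℕ) :
    genBinom (Q + 1) ((n + 1 : ℕ) : ℤ) = genBinom Q ((n + 1 : ℕ) : ℤ) + genBinom Q n := by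
  have hshift : ∏ j ∈ Finset.range n, (Q + 1 - ((j + 1 : ℕ) : ℚ)) =
      ∏ j ∈ Finset.range n, (Q - j) :=
    Finset.prod_congr rfl fun j _ => by push_cast; ring
  have hn : (n.factorial : ℚ) ≠ 0 := by exact_mod_cast n.factorial_ne_zero
  have hn' : (n : ℚ) + 1 ≠ 0 := by positivity
  simp only [genBinom_natCast_s5]
  rw [Finset.prod_range_succ', hshift, Finset.prod_range_succ, Nat.factorial_succ]
  push_cast
  field_simp
  ring

theorem Opoly_congr (N : ℤ) (Q : ℚ) {q j q' j' : ℤ} (h : q + j = q' + j') :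
    Opoly N Q q j = Opoly N Q q' j' := by
  have h' : N - q - j + 1 = N - q' - j' + 1 := by lia
  simp only [Opoly, h, h']

theorem Opoly_add_one (N : ℤ) (Q : ℚ) (q j : ℤ) :
    Opoly N (Q + 1) q j = Opoly N Q q j + Opoly N Q q (j + 1) := by
  unfold Opoly
  rcases hk : (N - q - j + 1).toNat with _ | k
  · have hk' : (N - q - (j + 1) + 1).toNat = 0 := by lia
    simp [hk']
  · have hk' : (N - q - (j + 1) + 1).toNat = k := by lia
    rw [hk', Finset.sum_range_succ', Finset.sum_range_succ' _ k,
      add_right_comm (∑ i ∈ Finset.range k, _) _ (∑ i ∈ Finset.range k, _),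
      ← Finset.sum_add_distrib]
    congr 1
    refine Finset.sum_congr rfl fun i _ => ?_
    have hi : q + (j + 1) + (i : ℤ) = q + j + ((i + 1 : ℕ) : ℤ) := by push_cast; ring
    rw [genBinom_add_one_succ, hi, Rat.cast_add, add_smul]

theorem Opoly_mem_Osub (N : ℤ) (Q : ℚ) (q : ℤ) {j : ℤ} (hj : j ≤ 0) :
    Opoly N Q q j ∈ Osub N Q q :=
  Submodule.subset_span (Or.inl ⟨j, hj, rfl⟩)

theorem T_mem_Osub (N : ℤ) (Q : ℚ) (q : ℤ) {i : ℤ} (hi : N + 1 ≤ i) :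
    LaurentPolynomial.T i ∈ Osub N Q q :=
  Submodule.subset_span (Or.inr ⟨i, hi, rfl⟩)

theorem Osub_mono_right (N : ℤ) (Q : ℚ) {q q' : ℤ} (h : q ≤ q') :
    Osub N Q q ≤ Osub N Q q' := by
  refine Submodule.span_le.2 ?_
  rintro _ (⟨j, hj, rfl⟩ | ⟨i, hi, rfl⟩)
  · rw [Opoly_congr N Q (show q + j = q' + (q + j - q') by ring)]
    exact Opoly_mem_Osub N Q q' (by lia)
  · exact T_mem_Osub N Q q' hi

theorem Osub_add_one_le (N : ℤ) (Q : ℚ) (q : ℤ) :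
    Osub N (Q + 1) (q - 1) ≤ Osub N Q q := by
  refine Submodule.span_le.2 ?_
  rintro _ (⟨j, hj, rfl⟩ | ⟨i, hi, rfl⟩)
  · rw [Opoly_congr N (Q + 1) (show q - 1 + j = q + (j - 1) by ring), Opoly_add_one,
      sub_add_cancel]
    exact add_mem (Opoly_mem_Osub N Q q (by lia)) (Opoly_mem_Osub N Q q hj)
  · exact T_mem_Osub N Q q hi

theorem Osub_add_natCast_le (N : ℤ) (Q : ℚ) (q : ℤ) (d : ℕ) :
    Osub N (Q + d) (q - d) ≤ Osub N Q q := by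
  induction d with
  | zero => simp
  | succ d ih =>
    refine le_trans ?_ ih
    have h := Osub_add_one_le N (Q + d) (q - d)
    rwa [add_assoc, sub_sub, ← Nat.cast_succ, ← Nat.cast_succ] at h

theorem mul_add_le_of_add_div_le {T a b a' b' : ℕ} (hT : 0 < T)
    (h : (a' : ℚ) + b' / T ≤ (a : ℚ) + b / T) : a' * T + b' ≤ a * T + b := by
  have hT' : (0 : ℚ) < T := by exact_mod_cast hT
  have h₂ := mul_le_mul_of_nonneg_right h hT'.le
  rw [add_mul, add_mul, div_mul_cancel₀ _ hT'.ne', div_mul_cancel₀ _ hT'.ne'] at h₂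
  exact_mod_cast h₂

theorem lt_or_eq_and_le_of_mul_add_le {T a b a' b' : ℕ} (hb : b < T)
    (h : a' * T + b' ≤ a * T + b) : a' < a ∨ a' = a ∧ b' ≤ b := by
  rcases lt_trichotomy a' a with h' | rfl | h'
  · exact Or.inl h'
  · exact Or.inr ⟨rfl, by lia⟩
  · have := Nat.mul_le_mul_right T (Nat.succ_le_of_lt h')
    rw [Nat.succ_mul] at this
    lia

theorem OTs_le_OTs {T : ℕ} (hT : 0 < T) (Δ : ℤ) {l₁ i₁ l₃ i₃ l₁' i₁' l₃' i₃' : ℕ}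
    (hi₁ : i₁ < T) (hi₃ : i₃ < T)
    (hm : (l₁' : ℚ) + i₁' / T ≤ (l₁ : ℚ) + i₁ / T)
    (hn : (l₃' : ℚ) + i₃' / T ≤ (l₃ : ℚ) + i₃ / T) (s : ℕ) (α β : ℤ) :
    OTs T Δ l₁ i₁ l₃ i₃ s α β ≤ OTs T Δ l₁' i₁' l₃' i₃' s α β := by
  have hm' := lt_or_eq_and_le_of_mul_add_le hi₁ (mul_add_le_of_add_div_le hT hm)
  have hn' := lt_or_eq_and_le_of_mul_add_le hi₃ (mul_add_le_of_add_div_le hT hn)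
  obtain ⟨d, hd⟩ : ∃ d : ℕ, l₁ + (if s ≤ i₁ then 1 else 0) =
      l₁' + (if s ≤ i₁' then 1 else 0) + d :=
    Nat.exists_eq_add_of_le (by split_ifs <;> lia)
  have he : l₃' + (if T ≤ s + i₃' then 1 else 0) ≤ l₃ + (if T ≤ s + i₃ then 1 else 0) := by
    split_ifs <;> lia
  have hQ : (α : ℚ) - 1 + l₁ + (if s ≤ i₁ then 1 else 0) + (s : ℚ) / T =
      (α : ℚ) - 1 + l₁' + (if s ≤ i₁' then 1 else 0) + (s : ℚ) / T + d := by
    have := congrArg (Nat.cast : ℕ → ℚ) hd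
    push_cast at this
    linarith
  unfold OTs
  rw [hQ]
  refine le_trans (Osub_mono_right _ _ ?_) (Osub_add_natCast_le _ _ _ d)
  split_ifs at hd he ⊢ <;> lia

theorem stmt5 (T : ℕ) (hT : 0 < T) (Δ : ℤ) (hΔ : Δ ≤ 0)
    (l₁ i₁ l₃ i₃ l₁' i₁' l₃' i₃' : ℕ)
    (hi₁ : i₁ < T) (hi₃ : i₃ < T) (hi₁' : i₁' < T) (hi₃' : i₃' < T)
    (hm : (l₁' : ℚ) + i₁' / T ≤ (l₁ : ℚ) + i₁ / T)
    (hn : (l₃' : ℚ) + i₃' / T ≤ (l₃ : ℚ) + i₃ / T) :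
    (∀ s < T, ∀ α β : ℤ, OTs T Δ l₁ i₁ l₃ i₃ s α β ≤ OTs T Δ l₁' i₁' l₃' i₃' s α β) ∧
    (∀ α β : ℤ, OT T Δ l₁ i₁ l₃ i₃ α β ≤ OT T Δ l₁' i₁' l₃' i₃' α β) := by
  have h := OTs_le_OTs hT Δ hi₁ hi₃ hm hn
  exact ⟨fun s _ => h s, fun α β => iInf₂_mono fun s _ => h s α β⟩
end

section
/- In the polynomial ring ℂ[x₀,…,x_{t−1}] one has the identity det A · ∏_{0≤i<j≤t−1} ∏_{k=−a+1}^{a−1} (a(j−i)+k)^{a−|k|} = ∏_{0≤i<j≤t−1} ∏_{k=−a+1}^{a−1} (x_i − x_j + k)^{a−|k|}; equivalently, det A = ∏_{0≤i<j≤t−1} ∏_{k=−a+1}^{a−1} ((x_i − x_j + k)/(a(j−i)+k))^{a−|k|}, where every scalar a(j−i)+k occurring is a nonzero integer. -/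
open Finset

/-- Binomial polynomial `C(y,n) = y(y−1)⋯(y−n+1)/n!` for `n ≥ 0`, and `0` for `n < 0`. -/
noncomputable def polyBinom (t : ℕ) (y : MvPolynomial (Fin t) ℂ) (n : ℤ) :
    MvPolynomial (Fin t) ℂ :=
  if 0 ≤ n then
    ((n.toNat.factorial : ℂ)⁻¹) • ∏ j ∈ Finset.range n.toNat, (y - (j : MvPolynomial (Fin t) ℂ))
  else 0

/-- `α_i^k(x_s) = Σ_{j=1}^{k} C(x_s, i+j)·C(−x_s, k−j)`. -/
noncomputable def alphaP (t : ℕ) (s : Fin t) (k : ℕ) (i : ℤ) : MvPolynomial (Fin t) ℂ :=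
  ∑ j ∈ Finset.Icc 1 k,
    polyBinom t (MvPolynomial.X s) (i + j) * polyBinom t (-(MvPolynomial.X s)) ((k : ℤ) - j)

/-- The `(at)×(at)` matrix `A = (A₀ ⋯ A_{t−1})`: rows and columns are indexed by
`Fin t × Fin a` via the bijection `(v,w) ↦ v·a + w + 1` (1-based); the entry in global row
`u = v·a + w + 1` and column `(s, k)` (block `s`, inner column `k+1`) is
`α^{k+1}_{(t−1)a−u}(x_s)`. -/
noncomputable def matA (t a : ℕ) :
    Matrix (Fin t × Fin a) (Fin t × Fin a) (MvPolynomial (Fin t) ℂ) :=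
  Matrix.of fun u c =>
    alphaP t c.1 (c.2.val + 1) (((t : ℤ) - 1) * a - ((u.1.val : ℤ) * a + u.2.val + 1))

theorem polyBinom_of_neg {t : ℕ} (y : MvPolynomial (Fin t) ℂ) {n : ℤ} (hn : n < 0) :
    polyBinom t y n = 0 := by
  simp [polyBinom, not_le.mpr hn]

theorem polyBinom_natCast {t : ℕ} (y : MvPolynomial (Fin t) ℂ) (n : ℕ) :
    polyBinom t y n =
      MvPolynomial.C ((n.factorial : ℂ)⁻¹) *
        ∏ j ∈ Finset.range n, (y - (j : MvPolynomial (Fin t) ℂ)) := by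
  simp [polyBinom, MvPolynomial.smul_eq_C_mul]

theorem polyBinom_zero {t : ℕ} (y : MvPolynomial (Fin t) ℂ) : polyBinom t y 0 = 1 := by
  simpa using polyBinom_natCast y 0

/-- Pascal's rule. -/
theorem polyBinom_add_one {t : ℕ} (y : MvPolynomial (Fin t) ℂ) (n : ℤ) :
    polyBinom t (y + 1) n = polyBinom t y n + polyBinom t y (n - 1) := by
  rcases lt_or_ge n 0 with hn | hn
  · simp [polyBinom_of_neg _ hn, polyBinom_of_neg _ (show n - 1 < 0 by omega)]
  lift n to ℕ using hn
  rcases n with _ | n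
  · simp [polyBinom_zero, polyBinom_of_neg]
  have h : ((n + 1 : ℕ) : ℤ) - 1 = (n : ℕ) := by push_cast; ring
  have hf : (n.factorial : ℂ)⁻¹ = ((n : ℂ) + 1) * ((n + 1).factorial : ℂ)⁻¹ := by
    have : (n.factorial : ℂ) ≠ 0 := by exact_mod_cast n.factorial_ne_zero
    have : (n : ℂ) + 1 ≠ 0 := by exact_mod_cast n.succ_ne_zero
    rw [Nat.factorial_succ]
    push_cast
    field_simp
  have hs : ∏ j ∈ Finset.range n, (y + 1 - ((j + 1 : ℕ) : MvPolynomial (Fin t) ℂ)) =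
      ∏ j ∈ Finset.range n, (y - (j : MvPolynomial (Fin t) ℂ)) :=
    Finset.prod_congr rfl fun j _ => by push_cast; ring
  rw [h, polyBinom_natCast, polyBinom_natCast, polyBinom_natCast, hf, Finset.prod_range_succ',
    Finset.prod_range_succ, hs]
  simp only [map_mul, map_add, map_natCast, map_one, Nat.cast_zero, sub_zero]
  ring

/-- The Chu–Vandermonde convolution for shifts by natural numbers. -/
theorem polyBinom_add_natCast {t : ℕ} (y : MvPolynomial (Fin t) ℂ) {m L : ℕ} (hm : m < L)
    (n : ℤ) :
    polyBinom t (y + m) n =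
      ∑ l ∈ Finset.range L, polyBinom t y (n - l) * (m.choose l : MvPolynomial (Fin t) ℂ) := by
  obtain ⟨L, rfl⟩ : ∃ L', L = L' + 1 := ⟨L - 1, by omega⟩
  induction m generalizing n with
  | zero => simp [Finset.sum_range_succ']
  | succ m ih =>
    have e : y + ((m + 1 : ℕ) : MvPolynomial (Fin t) ℂ) = (y + m) + 1 := by push_cast; ring
    rw [e, polyBinom_add_one, ih _ (by omega), ih _ (by omega), Finset.sum_range_succ',
      Finset.sum_range_succ
        (fun l : ℕ => polyBinom t y (n - 1 - l) * (m.choose l : MvPolynomial (Fin t) ℂ)),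
      Finset.sum_range_succ' _ L,
      Nat.choose_eq_zero_of_lt (show m < L by omega)]
    simp only [Nat.choose_succ_succ, Nat.cast_add, mul_add, Finset.sum_add_distrib,
      Nat.choose_zero_right, Nat.cast_zero, Nat.cast_one, mul_zero, add_zero]
    have e2 : ∀ l : ℕ, n - 1 - (l : ℤ) = n - (l + 1) := fun l => by ring
    simp only [e2]
    ring

/-- Column operations inside the blocks, by matrices of determinant one, do not change the
determinant. -/
theorem det_sum_mul_block {R : Type*} [CommRing R] {t a : ℕ}
    (B : Matrix (Fin t × Fin a) (Fin t × Fin a) R) (d : Fin t → Matrix (Fin a) (Fin a) R)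
    (hd : ∀ s, (d s).det = 1) :
    (Matrix.of fun u c => ∑ w, B u (c.1, w) * d c.1 w c.2).det = B.det := by
  have h : (Matrix.of fun u c => ∑ w, B u (c.1, w) * d c.1 w c.2) =
      B * (Matrix.blockDiagonal d).submatrix (Equiv.prodComm _ _) (Equiv.prodComm _ _) := by
    ext u ⟨s, w⟩
    simp [Matrix.mul_apply, Fintype.sum_prod_type, Matrix.blockDiagonal_apply]
  rw [h, Matrix.det_mul, Matrix.det_submatrix_equiv_self, Matrix.det_blockDiagonal]
  simp [hd]

/-- The matrix of binomial polynomials at the shifted variables `x_s + (a - 1 - w)`. -/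
noncomputable def shiftedBinomMatrix (t a : ℕ) :
    Matrix (Fin t × Fin a) (Fin t × Fin a) (MvPolynomial (Fin t) ℂ) :=
  Matrix.of fun u c => polyBinom t (MvPolynomial.X c.1 + ((c.2.rev : ℕ) : MvPolynomial (Fin t) ℂ))
    ((finProdFinEquiv u).rev : ℕ)

/-- The matrix of the coefficients of `z ^ (a - 1 - w) * (1 + z) ^ x_s`. -/
noncomputable def coeffBinomMatrix (t a : ℕ) :
    Matrix (Fin t × Fin a) (Fin t × Fin a) (MvPolynomial (Fin t) ℂ) :=
  Matrix.of fun u c => polyBinom t (MvPolynomial.X c.1)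
    (((finProdFinEquiv u).rev : ℕ) - ((c.2.rev : ℕ) : ℤ))

theorem det_shiftedBinomMatrix (t a : ℕ) :
    (shiftedBinomMatrix t a).det = (coeffBinomMatrix t a).det := by
  rw [← det_sum_mul_block (coeffBinomMatrix t a)
    (fun _ => Matrix.of fun w w' => (((w'.rev : ℕ).choose (w.rev : ℕ) : ℕ) :
      MvPolynomial (Fin t) ℂ))]
  · congr 1
    ext1 u c
    simp only [shiftedBinomMatrix, coeffBinomMatrix, Matrix.of_apply]
    rw [polyBinom_add_natCast _ c.2.rev.isLt, ← Fin.sum_univ_eq_sum_range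
      (fun l => polyBinom t (MvPolynomial.X c.1) ((((finProdFinEquiv u).rev : ℕ) : ℤ) - (l : ℤ)) *
        (((c.2.rev : ℕ).choose l : ℕ) : MvPolynomial (Fin t) ℂ)), ← Equiv.sum_comp Fin.revPerm]
    rfl
  · intro s
    rw [Matrix.det_of_isLowerTriangular]
    · simp
    · intro i j hij
      have : j.rev < i.rev := Fin.rev_lt_rev.mpr hij
      rw [Matrix.of_apply, Nat.choose_eq_zero_of_lt (show (j.rev : ℕ) < i.rev from this),
        Nat.cast_zero]

theorem det_matA (t a : ℕ) : (matA t a).det = (coeffBinomMatrix t a).det := by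
  rw [← det_sum_mul_block (coeffBinomMatrix t a)
    (fun s => Matrix.of fun w w' => polyBinom t (-(MvPolynomial.X s)) ((w' : ℤ) - (w : ℤ)))]
  · congr 1
    ext1 u c
    simp only [matA, coeffBinomMatrix, Matrix.of_apply, alphaP]
    have hI : ∀ g : ℕ → MvPolynomial (Fin t) ℂ,
        ∑ j ∈ Finset.Icc 1 ((c.2 : ℕ) + 1), g j = ∑ w ∈ Finset.range ((c.2 : ℕ) + 1), g (w + 1) :=
      fun g => by
        rw [Finset.range_eq_Ico, Finset.sum_Ico_add' g 0 _ 1]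
        rfl
    have hc := c.2.isLt
    rw [hI, Finset.sum_subset (Finset.range_subset_range.mpr (show (c.2 : ℕ) + 1 ≤ a from hc)),
      ← Fin.sum_univ_eq_sum_range]
    · refine Finset.sum_congr rfl fun w _ => ?_
      have hw := w.isLt
      congr 2
      · have hr : (((finProdFinEquiv u).rev : ℕ) : ℤ) =
            (t : ℤ) * a - ((u.1 : ℤ) * a + u.2 + 1) := by
          have hlt := (finProdFinEquiv u).isLt
          rw [Fin.val_rev, Nat.cast_sub hlt]
          push_cast [finProdFinEquiv_apply_val]
          ring
        have hwr : ((w.rev : ℕ) : ℤ) = (a : ℤ) - (w + 1) := by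
          rw [Fin.val_rev]
          omega
        rw [hr, hwr]
        push_cast
        ring
      · push_cast
        ring
    · intro w _ hw
      rw [Finset.mem_range] at hw
      rw [polyBinom_of_neg (-(MvPolynomial.X c.1)) (by push_cast; omega), mul_zero]
  · intro s
    rw [Matrix.det_of_isUpperTriangular]
    · simp [polyBinom_zero]
    · intro i j hij
      have hij : j < i := hij
      exact polyBinom_of_neg _ (by have : (j : ℕ) < i := hij; omega)

/-- Evaluations of binomial polynomials form a scaled Vandermonde matrix. -/
theorem exists_det_polyBinom_eq_mul_prod (t n : ℕ) :
    ∃ κ : MvPolynomial (Fin t) ℂ, ∀ y : Fin n → MvPolynomial (Fin t) ℂ,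
      (Matrix.of fun p q : Fin n => polyBinom t (y q) (p.rev : ℕ)).det =
        κ * ∏ p, ∏ q, if p < q then y p - y q else 1 := by
  refine ⟨(∏ p : Fin n, (MvPolynomial.C (((p.rev : ℕ).factorial : ℂ)⁻¹))) *
    (((Equiv.Perm.sign (Fin.revPerm : Equiv.Perm (Fin n)) : ℤ) : MvPolynomial (Fin t) ℂ) *
      ∏ p : Fin n, ∏ q ∈ Finset.Ioi p, -1), fun y => ?_⟩
  have h1 : (∏ p, ∏ q, if p < q then y p - y q else 1) =
      ∏ p, ∏ q ∈ Finset.Ioi p, (y p - y q) :=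
    Finset.prod_congr rfl fun p _ => by
      rw [← Finset.prod_filter]
      congr 1
      ext q
      simp
  have h2 : (Matrix.of fun p q : Fin n => polyBinom t (y q) (p.rev : ℕ)) =
      Matrix.of fun p q => MvPolynomial.C (((p.rev : ℕ).factorial : ℂ)⁻¹) *
        ((Matrix.of fun i j : Fin n => (descPochhammer (MvPolynomial (Fin t) ℂ) j).eval (y i)
          ).transpose.submatrix Fin.revPerm id) p q := by
    ext1 p q
    simp only [Matrix.of_apply, Matrix.submatrix_apply, Matrix.transpose_apply, id_eq,
      polyBinom_natCast, descPochhammer_eval_eq_prod_range, Fin.revPerm_apply]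
  rw [h2, Matrix.det_mul_column, Matrix.det_permute, Matrix.det_transpose,
    ← Matrix.det_eval_matrixOfPolynomials_eq_det_vandermonde y
      (fun j => descPochhammer (MvPolynomial (Fin t) ℂ) j)
      (fun j => descPochhammer_natDegree _ _) (fun j => monic_descPochhammer _ _),
    Matrix.det_vandermonde, h1, mul_assoc, mul_assoc, ← Finset.prod_mul_distrib]
  congr 2
  refine Finset.prod_congr rfl fun p _ => ?_
  rw [← Finset.prod_mul_distrib]
  exact Finset.prod_congr rfl fun q _ => by ring

theorem det_polyBinom_rev (t n : ℕ) :
    (Matrix.of fun p q : Fin n =>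
      polyBinom t ((q.rev : ℕ) : MvPolynomial (Fin t) ℂ) (p.rev : ℕ)).det = 1 := by
  rw [Matrix.det_of_isLowerTriangular]
  · refine Finset.prod_eq_one fun p _ => ?_
    simp only [Matrix.of_apply, polyBinom_natCast]
    have h : ∏ j ∈ Finset.range (p.rev : ℕ), (((p.rev : ℕ) : MvPolynomial (Fin t) ℂ) - j) =
        ((p.rev : ℕ).factorial : MvPolynomial (Fin t) ℂ) := by
      rw [← descPochhammer_eval_eq_prod_range, descPochhammer_eval_eq_descFactorial,
        Nat.descFactorial_self]
    rw [h, ← map_natCast (MvPolynomial.C : ℂ →+* MvPolynomial (Fin t) ℂ), ← map_mul,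
      inv_mul_cancel₀ (by exact_mod_cast Nat.factorial_ne_zero _), map_one]
  · intro p q hpq
    have : q.rev < p.rev := Fin.rev_lt_rev.mpr hpq
    rw [Matrix.of_apply, polyBinom_natCast, Finset.prod_eq_zero (Finset.mem_range.mpr this)
      (sub_self _), mul_zero]

theorem card_filter_sub_eq (a : ℕ) {k : ℤ} (hk : k ∈ Finset.Icc (-(a : ℤ) + 1) ((a : ℤ) - 1)) :
    #{p : Fin a × Fin a | (p.2 : ℤ) - (p.1 : ℤ) = k} = a - k.natAbs := by
  rw [Finset.mem_Icc] at hk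
  rw [← Finset.card_range (a - k.natAbs)]
  symm
  refine Finset.card_bij
    (fun i hi => (⟨i + (-k).toNat, by have := Finset.mem_range.mp hi; omega⟩,
      ⟨i + k.toNat, by have := Finset.mem_range.mp hi; omega⟩)) ?_ ?_ ?_
  · intro i _
    simp only [Finset.mem_filter, Finset.mem_univ, true_and]
    push_cast
    omega
  · intro i _ j _ h
    simp only [Prod.mk.injEq, Fin.mk.injEq] at h
    omega
  · rintro ⟨⟨p, hp⟩, ⟨q, hq⟩⟩ h
    simp only [Finset.mem_filter, Finset.mem_univ, true_and] at h
    refine ⟨min p q, ?_, ?_⟩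
    · rw [Finset.mem_range]
      omega
    · simp only [Prod.mk.injEq, Fin.mk.injEq]
      omega

theorem prod_prod_sub_eq_prod_pow {M : Type*} [CommMonoid M] (a : ℕ) (f : ℤ → M) :
    ∏ w : Fin a, ∏ w' : Fin a, f ((w' : ℤ) - (w : ℤ)) =
      ∏ k ∈ Finset.Icc (-(a : ℤ) + 1) ((a : ℤ) - 1), f k ^ (a - k.natAbs) := by
  rw [← Fintype.prod_prod_type', ← Finset.prod_fiberwise_of_maps_to
    (g := fun p : Fin a × Fin a => (p.2 : ℤ) - (p.1 : ℤ))
    (t := Finset.Icc (-(a : ℤ) + 1) ((a : ℤ) - 1))]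
  · refine Finset.prod_congr rfl fun k hk => ?_
    rw [← card_filter_sub_eq a hk, ← Finset.prod_const]
    exact Finset.prod_congr rfl fun p hp => by rw [(Finset.mem_filter.mp hp).2]
  · rintro ⟨p, q⟩ -
    simp only [Finset.mem_Icc]
    omega

theorem finProdFinEquiv_lt_iff {t a : ℕ} (s s' : Fin t) (w w' : Fin a) :
    finProdFinEquiv (s, w) < finProdFinEquiv (s', w') ↔ s < s' ∨ s = s' ∧ w < w' := by
  have hw := w.isLt
  have hw' := w'.isLt
  simp only [Fin.lt_def, finProdFinEquiv_apply_val, Fin.ext_iff]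
  rcases lt_trichotomy (s : ℕ) s' with h | h | h
  · have := Nat.mul_le_mul_left a (Nat.succ_le_of_lt h)
    rw [Nat.mul_succ] at this
    omega
  · rw [h]
    omega
  · have := Nat.mul_le_mul_left a (Nat.succ_le_of_lt h)
    rw [Nat.mul_succ] at this
    omega

/-- The product of the differences of the shifted values `x_s + (a - 1 - w)`. -/
theorem prod_lt_shifted {R : Type*} [CommRing R] (t a : ℕ) (x : Fin t → R)
    (y : Fin (t * a) → R)
    (hy : ∀ s w, y (finProdFinEquiv (s, w)) = x s + ((w.rev : ℕ) : R)) :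
    (∏ p, ∏ q, if p < q then y p - y q else 1) =
      (∏ _s : Fin t, ∏ w : Fin a, ∏ w' : Fin a, if w < w' then ((w' : ℤ) - (w : ℤ) : R) else 1) *
      ∏ i, ∏ j ∈ Finset.Ioi i, ∏ k ∈ Finset.Icc (-(a : ℤ) + 1) ((a : ℤ) - 1),
        (x i - x j + (k : R)) ^ (a - k.natAbs) := by
  have key : ∀ (i j : Fin t) (w w' : Fin a),
      x i + ((w.rev : ℕ) : R) - (x j + ((w'.rev : ℕ) : R)) =
        x i - x j + (((w' : ℤ) - (w : ℤ) : ℤ) : R) := by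
    intro i j w w'
    have : (((w.rev : ℕ) : ℤ) - ((w'.rev : ℕ) : ℤ)) = (w' : ℤ) - (w : ℤ) := by
      simp only [Fin.val_rev]
      omega
    rw [← this]
    push_cast
    ring
  rw [← Finset.prod_mul_distrib, ← Equiv.prod_comp finProdFinEquiv, Fintype.prod_prod_type]
  refine Finset.prod_congr rfl fun i _ => ?_
  have hj : ∀ w : Fin a,
      (∏ q, if finProdFinEquiv (i, w) < q then y (finProdFinEquiv (i, w)) - y q else 1) =
        (∏ w' : Fin a, if w < w' then ((w' : ℤ) - (w : ℤ) : R) else 1) *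
        ∏ j ∈ Finset.Ioi i, ∏ w' : Fin a, (x i - x j + (((w' : ℤ) - (w : ℤ) : ℤ) : R)) := by
    intro w
    rw [← Equiv.prod_comp finProdFinEquiv, Fintype.prod_prod_type]
    simp only [finProdFinEquiv_lt_iff, hy, key]
    rw [← Finset.mul_prod_erase _ _ (Finset.mem_univ i)]
    congr 1
    · simp
    · have hsub : Finset.Ioi i ⊆ Finset.univ.erase i := fun j hj => by
        simpa using (Finset.mem_Ioi.mp hj).ne'
      rw [← Finset.prod_subset hsub]
      · refine Finset.prod_congr rfl fun j hj => ?_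
        simp [Finset.mem_Ioi.mp hj]
      · intro j hj hj'
        have h1 : j ≠ i := by simpa using hj
        have h2 : ¬ i < j := by simpa using hj'
        simp [h1.symm, h2]
  simp only [hj]
  rw [Finset.prod_mul_distrib]
  congr 1
  rw [Finset.prod_comm]
  refine Finset.prod_congr rfl fun j _ => ?_
  exact prod_prod_sub_eq_prod_pow a (fun k : ℤ => x i - x j + (k : R))

theorem mul_sub_add_ne_zero {a : ℕ} {i j : ℕ} (hij : i < j) {k : ℤ}
    (hk : k ∈ Finset.Icc (-(a : ℤ) + 1) ((a : ℤ) - 1)) :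
    (a : ℤ) * ((j : ℤ) - i) + k ≠ 0 := by
  rw [Finset.mem_Icc] at hk
  nlinarith [mul_le_mul_of_nonneg_left (show (1 : ℤ) ≤ (j : ℤ) - i by omega)
    (Int.natCast_nonneg a)]

theorem stmt15 (t a : ℕ) (ht : 0 < t) (ha : 0 < a) :
    (∀ i j : Fin t, i < j → ∀ k ∈ Finset.Icc (-(a : ℤ) + 1) ((a : ℤ) - 1),
        (a : ℤ) * ((j.val : ℤ) - i.val) + k ≠ 0) ∧
    (matA t a).det *
        MvPolynomial.C
          (((∏ i : Fin t, ∏ j ∈ Finset.Ioi i, ∏ k ∈ Finset.Icc (-(a : ℤ) + 1) ((a : ℤ) - 1),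
            ((a : ℤ) * ((j.val : ℤ) - i.val) + k) ^ (a - k.natAbs) : ℤ) : ℂ))
      = ∏ i : Fin t, ∏ j ∈ Finset.Ioi i, ∏ k ∈ Finset.Icc (-(a : ℤ) + 1) ((a : ℤ) - 1),
          (MvPolynomial.X i - MvPolynomial.X j + MvPolynomial.C (k : ℂ)) ^ (a - k.natAbs) := by
  refine ⟨fun i j hij k hk => mul_sub_add_ne_zero hij hk, ?_⟩
  obtain ⟨κ, hκ⟩ := exists_det_polyBinom_eq_mul_prod t (t * a)
  set y : Fin (t * a) → MvPolynomial (Fin t) ℂ := fun q =>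
    MvPolynomial.X (finProdFinEquiv.symm q).1 +
      (((finProdFinEquiv.symm q).2.rev : ℕ) : MvPolynomial (Fin t) ℂ) with hy
  have hA : (matA t a).det =
      (Matrix.of fun p q : Fin (t * a) => polyBinom t (y q) (p.rev : ℕ)).det := by
    rw [det_matA, ← det_shiftedBinomMatrix, ← Matrix.det_submatrix_equiv_self finProdFinEquiv]
    congr 1
    ext1 u c
    simp only [shiftedBinomMatrix, hy, Matrix.of_apply, Matrix.submatrix_apply,
      Equiv.symm_apply_apply]
  have h1 := prod_lt_shifted t a (fun s => (MvPolynomial.X s : MvPolynomial (Fin t) ℂ)) y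
    (fun s w => by simp only [hy, Equiv.symm_apply_apply])
  have h2 := prod_lt_shifted t a
    (fun s => ((a * (s.rev : ℕ) : ℕ) : MvPolynomial (Fin t) ℂ))
    (fun q : Fin (t * a) => ((q.rev : ℕ) : MvPolynomial (Fin t) ℂ)) (fun s w => by
      have : ((finProdFinEquiv (s, w)).rev : ℕ) = a * (s.rev : ℕ) + (w.rev : ℕ) := by
        obtain ⟨r, hr⟩ := Nat.exists_eq_add_of_lt s.isLt
        have hs : (s.rev : ℕ) = r := by rw [Fin.val_rev]; omega
        have hta : t * a = a * s + a * r + a :=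
          (congrArg (· * a) hr).trans (by ring)
        rw [hs]
        have := w.isLt
        simp only [Fin.val_rev, finProdFinEquiv_apply_val]
        omega
      rw [this]
      push_cast
      rfl)
  have h3 := hκ (fun q : Fin (t * a) => ((q.rev : ℕ) : MvPolynomial (Fin t) ℂ))
  rw [det_polyBinom_rev, h2] at h3
  have h4 : (MvPolynomial.C
          (((∏ i : Fin t, ∏ j ∈ Finset.Ioi i, ∏ k ∈ Finset.Icc (-(a : ℤ) + 1) ((a : ℤ) - 1),
            ((a : ℤ) * ((j.val : ℤ) - i.val) + k) ^ (a - k.natAbs) : ℤ) : ℂ)) :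
          MvPolynomial (Fin t) ℂ) =
      ∏ i : Fin t, ∏ j ∈ Finset.Ioi i, ∏ k ∈ Finset.Icc (-(a : ℤ) + 1) ((a : ℤ) - 1),
        (((a * (i.rev : ℕ) : ℕ) : MvPolynomial (Fin t) ℂ) - ((a * (j.rev : ℕ) : ℕ) :
          MvPolynomial (Fin t) ℂ) + (k : MvPolynomial (Fin t) ℂ)) ^ (a - k.natAbs) := by
    rw [map_intCast, Int.cast_prod]
    refine Finset.prod_congr rfl fun i _ => ?_
    rw [Int.cast_prod]
    refine Finset.prod_congr rfl fun j _ => ?_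
    rw [Int.cast_prod]
    refine Finset.prod_congr rfl fun k _ => ?_
    have : (j : ℤ) - (i : ℤ) = ((i.rev : ℕ) : ℤ) - ((j.rev : ℕ) : ℤ) := by
      simp only [Fin.val_rev]
      omega
    rw [this]
    push_cast
    ring
  simp only [map_intCast]
  rw [hA, hκ y, h1, ← map_intCast (MvPolynomial.C : ℂ →+* MvPolynomial (Fin t) ℂ), h4]
  linear_combination (-∏ i : Fin t, ∏ j ∈ Finset.Ioi i,
    ∏ k ∈ Finset.Icc (-(a : ℤ) + 1) ((a : ℤ) - 1),
      (MvPolynomial.X i - MvPolynomial.X j + (k : MvPolynomial (Fin t) ℂ)) ^ (a - k.natAbs)) * h3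
end

section
/- Let Q₀,…,Q_{t−1} ∈ ℚ satisfy Q_i − Q_j ∉ ℤ for all i ≠ j. Then the complex (at)×(at) matrix obtained from A by evaluating x_s ↦ Q_s for each s = 0,…,t−1 has nonzero determinant, i.e. is invertible. -/
open Finset

namespace BinomialMatrix

/-- The generalized binomial coefficient `C(y,n)` of a complex number, zero for `n < 0`. -/
noncomputable def intChoose (y : ℂ) (n : ℤ) : ℂ :=
  if 0 ≤ n then Ring.choose y n.toNat else 0

lemma choose_eq_inv_factorial_mul_prod (y : ℂ) (n : ℕ) :
    Ring.choose y n = (n.factorial : ℂ)⁻¹ * ∏ j ∈ range n, (y - j) := by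
  rw [Ring.choose_eq_smul, ← descPochhammer_eval_eq_prod_range, ← descPochhammer_map (Int.castRingHom ℂ),
    Polynomial.eval_map, ← Polynomial.aeval_eq_smeval]
  rfl

lemma intChoose_zero_right (y : ℂ) : intChoose y 0 = 1 := by
  simp [intChoose]

lemma intChoose_of_neg (y : ℂ) {n : ℤ} (hn : n < 0) : intChoose y n = 0 :=
  if_neg hn.not_ge

lemma intChoose_add_one (y : ℂ) (n : ℤ) :
    intChoose (y + 1) n = intChoose y n + intChoose y (n - 1) := by
  rcases lt_trichotomy n 0 with h | rfl | h
  · simp [intChoose_of_neg _ h, intChoose_of_neg y (show n - 1 < 0 by omega)]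
  · simp [intChoose]
  · obtain ⟨k, rfl⟩ : ∃ k : ℕ, n = k + 1 := ⟨(n - 1).toNat, by omega⟩
    have h₁ : (0 : ℤ) ≤ k + 1 := by omega
    have h₂ : ((k : ℤ) + 1).toNat = k + 1 := by omega
    simp [intChoose, h₁, h₂, Ring.choose_succ_succ, add_comm]

lemma intChoose_natCast (m n : ℕ) : intChoose (m : ℂ) (n : ℤ) = m.choose n := by
  simp [intChoose, Ring.choose_natCast]

lemma eval_polyBinom {t : ℕ} (x : Fin t → ℂ) (y : MvPolynomial (Fin t) ℂ) (n : ℤ) :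
    MvPolynomial.eval x (polyBinom t y n) = intChoose (MvPolynomial.eval x y) n := by
  unfold polyBinom intChoose
  split_ifs
  · simp [choose_eq_inv_factorial_mul_prod, MvPolynomial.smul_eval]
  · simp

lemma eval_alphaP {t : ℕ} (x : Fin t → ℂ) (s : Fin t) (k : ℕ) (i : ℤ) :
    MvPolynomial.eval x (alphaP t s k i) =
      ∑ j ∈ Icc 1 k, intChoose (x s) (i + j) * intChoose (-x s) ((k : ℤ) - j) := by
  simp [alphaP, eval_polyBinom]

/-- A triangular system with unit diagonal has only the zero solution. -/
lemma eq_zero_of_sum_mul_intChoose_eq_zero {a : ℕ} {g : ℕ → ℂ} {y : ℂ}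
    (h : ∀ k, 1 ≤ k → k ≤ a → ∑ j ∈ Icc 1 k, g j * intChoose y ((k : ℤ) - j) = 0) :
    ∀ k, 1 ≤ k → k ≤ a → g k = 0 := by
  intro k
  induction k using Nat.strong_induction_on with
  | _ k ih =>
    intro hk hka
    have hs := h k hk hka
    rw [sum_eq_single k] at hs
    · simpa [intChoose_zero_right] using hs
    · intro j hj hjk
      rw [mem_Icc] at hj
      rw [ih j (by omega) hj.1 (by omega), zero_mul]
    · intro hk'
      exact absurd (mem_Icc.2 ⟨hk, le_rfl⟩) hk'

section Combination

variable {ι : Type*} [Fintype ι] (c : ι → ℂ) (r : ι → ℕ)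

/-- If the first `a` differences of a combination of binomials vanish at `y`, the combination
vanishes at `y, y + 1, …, y + a - 1`. -/
lemma sum_intChoose_add_eq_zero {a : ℕ} {y : ℂ}
    (h : ∀ d < a, ∑ u, c u * intChoose y ((r u : ℤ) - d) = 0) (m : ℕ) :
    ∀ d, d + m < a → ∑ u, c u * intChoose (y + m) ((r u : ℤ) - d) = 0 := by
  induction m with
  | zero => simpa using h
  | succ m ih =>
    intro d hd
    have h₁ := ih d (by omega)
    have h₂ := ih (d + 1) (by omega)
    rw [← add_zero (0 : ℂ)]
    nth_rw 1 [← h₁]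
    rw [← h₂, ← sum_add_distrib]
    refine sum_congr rfl fun u _ => ?_
    rw [← mul_add, Nat.cast_succ, ← add_assoc, intChoose_add_one]
    push_cast
    rw [sub_sub]

lemma exists_polynomial_eval_eq_sum_intChoose {N : ℕ} (hr : ∀ u, r u < N) (hN : 0 < N) :
    ∃ p : Polynomial ℂ, p.natDegree < N ∧ ∀ y, p.eval y = ∑ u, c u * intChoose y (r u) := by
  refine ⟨∑ u, Polynomial.C (c u * ((r u).factorial : ℂ)⁻¹) * descPochhammer ℂ (r u), ?_, ?_⟩
  · refine (Polynomial.natDegree_sum_le_of_forall_le (n := N - 1) _ _ fun u _ => ?_).trans_lt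
      (by omega)
    refine (Polynomial.natDegree_C_mul_le _ _).trans ?_
    rw [descPochhammer_natDegree]
    have := hr u
    omega
  · intro y
    rw [Polynomial.eval_finsetSum]
    refine sum_congr rfl fun u _ => ?_
    simp [intChoose, choose_eq_inv_factorial_mul_prod, descPochhammer_eval_eq_prod_range, mul_assoc]

lemma eq_zero_of_sum_intChoose_natCast_eq_zero (hr : Function.Injective r)
    (h : ∀ m : ℕ, ∑ u, c u * intChoose (m : ℂ) (r u) = 0) : c = 0 := by
  suffices ∀ n u, r u = n → c u = 0 from funext fun u => this _ u rfl
  intro n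
  induction n using Nat.strong_induction_on with
  | _ n ih =>
    rintro u rfl
    have hs := h (r u)
    rw [sum_eq_single u] at hs
    · simpa [intChoose_natCast] using hs
    · intro v _ hvu
      rw [intChoose_natCast]
      rcases lt_trichotomy (r v) (r u) with hlt | heq | hgt
      · rw [ih _ hlt v rfl, zero_mul]
      · exact absurd (hr heq) hvu
      · simp [Nat.choose_eq_zero_of_lt hgt]
    · simp

end Combination

/-- The index `at - 1 - (va + w)` of the row `(v, w)` counted from the bottom. -/
def revIndex {t a : ℕ} (u : Fin t × Fin a) : ℕ := t * a - 1 - (u.1.val * a + u.2.val)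

lemma index_lt {t a : ℕ} (u : Fin t × Fin a) : u.1.val * a + u.2.val < t * a := by
  have h : (u.1.val + 1) * a ≤ t * a := Nat.mul_le_mul_right _ u.1.isLt
  have := u.2.isLt
  rw [add_mul, one_mul] at h
  omega

lemma revIndex_injective {t a : ℕ} : Function.Injective (revIndex (t := t) (a := a)) := by
  intro u v h
  have hu := index_lt u
  have hv := index_lt v
  have huv : a * u.1.val + u.2.val = a * v.1.val + v.2.val := by
    unfold revIndex at h
    rw [mul_comm a, mul_comm a]
    omega
  have ha : 0 < a := u.2.pos
  have h₁ := congrArg (· / a) huv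
  have h₂ := congrArg (· % a) huv
  simp only [Nat.mul_add_div ha, Nat.div_eq_of_lt u.2.isLt, Nat.div_eq_of_lt v.2.isLt,
    Nat.mul_add_mod, Nat.mod_eq_of_lt u.2.isLt, Nat.mod_eq_of_lt v.2.isLt, add_zero] at h₁ h₂
  exact Prod.ext (Fin.ext h₁) (Fin.ext h₂)

lemma add_natCast_injective {t a : ℕ} {Q : Fin t → ℚ}
    (hQ : ∀ i j : Fin t, i ≠ j → ∀ z : ℤ, Q i - Q j ≠ z) :
    Function.Injective fun x : Fin t × Fin a => ((Q x.1 : ℂ) + (x.2.val : ℂ)) := by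
  rintro ⟨i, m⟩ ⟨j, n⟩ h
  have h' : Q i + m.val = Q j + n.val := by
    dsimp only at h
    exact_mod_cast h
  obtain rfl : i = j := by
    by_contra hij
    refine hQ i j hij ((n.val : ℤ) - m.val) ?_
    push_cast
    linarith
  have : m.val = n.val := by exact_mod_cast add_left_cancel h'
  rw [Fin.ext this]

end BinomialMatrix

open BinomialMatrix

theorem stmt16 (t a : ℕ) (ht : 0 < t) (ha : 0 < a) (Q : Fin t → ℚ)
    (hQ : ∀ i j : Fin t, i ≠ j → ∀ z : ℤ, Q i - Q j ≠ z) :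
    (Matrix.of fun u c : Fin t × Fin a =>
        MvPolynomial.eval (fun s => ((Q s : ℂ))) (matA t a u c)).det ≠ 0 := by
  intro hdet
  obtain ⟨c, hc, hker⟩ := Matrix.exists_vecMul_eq_zero_iff.2 hdet
  apply hc
  have hN : 0 < t * a := Nat.mul_pos ht ha
  have hdiff : ∀ s : Fin t, ∀ d < a,
      ∑ u, c u * intChoose (Q s) ((revIndex u : ℤ) - d) = 0 := by
    intro s d hd
    have key := eq_zero_of_sum_mul_intChoose_eq_zero (a := a) (y := -(Q s : ℂ))
      (g := fun j => ∑ u : Fin t × Fin a, c u * intChoose (Q s)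
        (((t : ℤ) - 1) * a - ((u.1.val : ℤ) * a + u.2.val + 1) + j)) ?_ (a - d) (by omega) (by omega)
    · rw [← key]
      refine sum_congr rfl fun u _ => ?_
      have hu := index_lt u
      congr 2
      unfold revIndex
      rw [Nat.cast_sub (by omega), Nat.cast_sub (by omega), Nat.cast_sub hd.le]
      push_cast
      ring
    · intro k hk hka
      have hcol := congrFun hker (s, ⟨k - 1, by omega⟩)
      simp only [Matrix.vecMul, dotProduct, Matrix.of_apply, matA, eval_alphaP, Pi.zero_apply,
        Nat.sub_add_cancel hk] at hcol
      rw [← hcol]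
      simp only [sum_mul, mul_sum]
      rw [sum_comm]
      simp only [mul_assoc]
  obtain ⟨p, hdeg, hp⟩ := exists_polynomial_eval_eq_sum_intChoose c revIndex
    (N := t * a) (fun u => by unfold revIndex; omega) hN
  have hp0 : p = 0 := by
    refine Polynomial.eq_zero_of_natDegree_lt_card_of_eval_eq_zero p
      (add_natCast_injective (a := a) hQ) (fun x => ?_) (by simpa using hdeg)
    rw [hp]
    simpa using sum_intChoose_add_eq_zero c revIndex (hdiff x.1) x.2.val 0 (by simp)
  refine eq_zero_of_sum_intChoose_natCast_eq_zero c revIndex revIndex_injective fun m => ?_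
  rw [← hp, hp0, Polynomial.eval_zero]
end

section
/- Let B = (B₀ B₁ ⋯ B_{t−1}) be the (at)×(at) matrix over ℂ[x₀,…,x_{t−1}] whose block B_s is the (at)×a matrix with (u,v)-entry C(x_s, (t−1)a − u + v) for rows u = 1,…,at and columns v = 1,…,a. Then det A = det B in ℂ[x₀,…,x_{t−1}]. -/
open Finset

/-- The matrix `B = (B₀ ⋯ B_{t−1})` whose entry in global row `u = v·a + w + 1` and
column `(s, k)` (block `s`, inner column `k+1`) is `C(x_s, (t−1)a − u + (k+1))`. -/
noncomputable def matB (t a : ℕ) :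
    Matrix (Fin t × Fin a) (Fin t × Fin a) (MvPolynomial (Fin t) ℂ) :=
  Matrix.of fun u c =>
    polyBinom t (MvPolynomial.X c.1)
      (((t : ℤ) - 1) * a - ((u.1.val : ℤ) * a + u.2.val + 1) + (c.2.val + 1))

/-- The upper unitriangular Toeplitz matrix with entries `C(y, k - j)`. -/
noncomputable def binomToeplitz (t a : ℕ) (y : MvPolynomial (Fin t) ℂ) :
    Matrix (Fin a) (Fin a) (MvPolynomial (Fin t) ℂ) :=
  Matrix.of fun j k => polyBinom t y ((k.val : ℤ) - j.val)

theorem det_binomToeplitz (t a : ℕ) (y : MvPolynomial (Fin t) ℂ) :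
    (binomToeplitz t a y).det = 1 := by
  rw [Matrix.det_of_isUpperTriangular]
  · simp [binomToeplitz, polyBinom_zero]
  · intro i j hij
    have hij' : j.val < i.val := hij
    exact polyBinom_of_neg _ (by omega)

theorem alphaP_eq_sum_fin (t a : ℕ) (s : Fin t) (k : Fin a) (i : ℤ) :
    alphaP t s (k.val + 1) i =
      ∑ j : Fin a, polyBinom t (MvPolynomial.X s) (i + (j.val + 1)) *
        binomToeplitz t a (-(MvPolynomial.X s)) j k := by
  let f : ℕ → MvPolynomial (Fin t) ℂ := fun j =>
    polyBinom t (MvPolynomial.X s) (i + (j + 1)) *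
      polyBinom t (-(MvPolynomial.X s)) ((k.val : ℤ) - j)
  calc alphaP t s (k.val + 1) i = ∑ j ∈ range (k.val + 1), f j := by
        rw [alphaP, ← Finset.Ico_add_one_right_eq_Icc, Finset.sum_Ico_eq_sum_range]
        refine Finset.sum_congr (by simp) fun j _ => ?_
        simp only [f]
        congr 2 <;> push_cast <;> ring
    _ = ∑ j ∈ range a, f j := by
        refine Finset.sum_subset (Finset.range_subset_range.2 k.isLt) fun j _ hj => ?_
        rw [Finset.mem_range] at hj
        exact mul_eq_zero_of_right _ (polyBinom_of_neg _ (by omega))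
    _ = _ := (Fin.sum_univ_eq_sum_range f a).symm

theorem matA_eq_matB_mul (t a : ℕ) :
    matA t a = matB t a *
      (Matrix.blockDiagonal fun s : Fin t =>
        binomToeplitz t a (-(MvPolynomial.X s))).submatrix Prod.swap Prod.swap := by
  ext1 u ⟨s, k⟩
  rw [Matrix.mul_apply, Fintype.sum_prod_type, Finset.sum_eq_single s]
  · simp [matA, matB, alphaP_eq_sum_fin, Matrix.blockDiagonal_apply]
  · intro s' _ hs
    simp [Matrix.blockDiagonal_apply, hs]
  · simp

theorem stmt17 (t a : ℕ) (ht : 0 < t) (ha : 0 < a) :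
    (matA t a).det = (matB t a).det := by
  rw [matA_eq_matB_mul, Matrix.det_mul]
  have h := Matrix.det_submatrix_equiv_self (Equiv.prodComm (Fin t) (Fin a))
    (Matrix.blockDiagonal fun s : Fin t => binomToeplitz t a (-(MvPolynomial.X s)))
  rw [Equiv.coe_prodComm] at h
  simp [h, Matrix.det_blockDiagonal, det_binomToeplitz]
end
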